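/- Let $A$ be an $F$-finite Noetherian locally equidimensional ring of prime characteristic $p > 0$, and let $\mathfrak{p} \subseteq \mathfrak{q}$ be prime ideals of $A$. Then for every $e > 0$, $[\kappa(\mathfrak{p})^{1/p^e}:\kappa(\mathfrak{p})] \cdot p^{e \dim(A_\mathfrak{p})} = [\kappa(\mathfrak{q})^{1/p^e}:\kappa(\mathfrak{q})] \cdot p^{e \dim(A_\mathfrak{q})}$. Consequently the function $\Spec(A) \to \mathbb{N}$, $\mathfrak{p} \mapsto [\kappa(\mathfrak{p})^{1/p^e}:\kappa(\mathfrak{p})] p^{e\dim(A_\mathfrak{p})}$, is constant on each connected component of $\Spec(A)$. -/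

import Mathlib

open Module IsLocalRing

section Frob

/-- `F^e_* M`: the abelian group `M` with `R`-module structure restricted along the
`e`-th iterated Frobenius of `R`. -/
def FrobMod (p e : ℕ) (R M : Type*) : Type _ := M

instance FrobMod.addCommGroup {p e : ℕ} {R M : Type*} [AddCommGroup M] :
    AddCommGroup (FrobMod p e R M) :=
  inferInstanceAs (AddCommGroup M)

noncomputable instance FrobMod.module {p e : ℕ} {R M : Type*} [CommRing R] [ExpChar R p]
    [AddCommGroup M] [Module R M] : Module R (FrobMod p e R M) :=
  Module.compHom M (iterateFrobenius R p e)

/-- `F^e_* B` (a.k.a. `B^{1/p^e}`) as a ring. -/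
def FrobAlg (p e : ℕ) (B : Type*) : Type _ := B

instance FrobAlg.commRing {p e : ℕ} {B : Type*} [CommRing B] : CommRing (FrobAlg p e B) :=
  inferInstanceAs (CommRing B)

/-- If `B` is an `A`-algebra, then `F^e_* B` is an `A`-algebra via `A → B` composed with
the `e`-th iterated Frobenius of `B`. -/
noncomputable instance FrobAlg.algebra {p e : ℕ} {A B : Type*} [CommRing A] [CommRing B]
    [Algebra A B] [ExpChar B p] : Algebra A (FrobAlg p e B) :=
  ((iterateFrobenius B p e).comp (algebraMap A B)).toAlgebra

/-- The `p`-degree `[k^{1/p^e} : k]` of a ring `k` of characteristic `p`. -/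
noncomputable def pDeg (p e : ℕ) (k : Type*) [CommRing k] [ExpChar k p] : ℕ :=
  Module.finrank k (FrobAlg p e k)

/-- The length of an `R`-module `M`, as the Krull dimension of its submodule lattice. -/
noncomputable def modLength (R M : Type*) [CommRing R] [AddCommGroup M] [Module R M] :
    WithBot ℕ∞ :=
  Order.krullDim (Submodule R M)

/-- The minimal number of generators of an `R`-module `M`. -/
noncomputable def minGens (R M : Type*) [CommRing R] [AddCommGroup M] [Module R M] : ℕ :=
  sInf {n : ℕ | ∃ s : Finset M, s.card = n ∧ Submodule.span R (s : Set M) = ⊤}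

/-- The bracket power `I^{[p^e]}`. -/
noncomputable def bracketPow {R : Type*} [CommRing R] (p e : ℕ) [ExpChar R p] (I : Ideal R) :
    Ideal R :=
  I.map (iterateFrobenius R p e)

end Frob

/-- A ring is equidimensional if all its minimal primes have quotients of the same
(Krull) dimension, namely `dim A`. -/
def RingEquidim (A : Type*) [CommRing A] : Prop :=
  ∀ P ∈ minimalPrimes A, ringKrullDim (A ⧸ P) = ringKrullDim A

theorem Module.length_quotient_range_comp {R A B C : Type*} [CommRing R] [AddCommGroup A]
    [AddCommGroup B] [AddCommGroup C] [Module R A] [Module R B] [Module R C]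
    (f : A →ₗ[R] B) (g : B →ₗ[R] C) (hg : Function.Injective g) :
    Module.length R (C ⧸ LinearMap.range (g ∘ₗ f)) =
      Module.length R (B ⧸ LinearMap.range f) + Module.length R (C ⧸ LinearMap.range g) := by
  refine Module.length_eq_add_of_exact
    (Submodule.mapQ (LinearMap.range f) (LinearMap.range (g ∘ₗ f)) g ?_)
    (Submodule.factor (LinearMap.range_comp_le_range f g)) ?_ ?_ ?_
  · rintro _ ⟨a, rfl⟩
    exact ⟨a, rfl⟩
  · rw [← LinearMap.ker_eq_bot, Submodule.ker_mapQ, LinearMap.range_comp,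
      Submodule.comap_map_eq_of_injective hg, Submodule.mkQ_map_self]
  · exact Submodule.factor_surjective _
  · rw [LinearMap.exact_iff, Submodule.range_mapQ]
    ext x
    obtain ⟨c, rfl⟩ := Submodule.mkQ_surjective _ x
    rw [LinearMap.mem_ker, Submodule.factor_mk, Submodule.mkQ_apply, Submodule.Quotient.mk_eq_zero]
    constructor
    · rintro ⟨b, rfl⟩
      exact ⟨g b, ⟨b, rfl⟩, rfl⟩
    · rintro ⟨_, ⟨b, rfl⟩, h⟩
      obtain ⟨a, ha⟩ := (Submodule.Quotient.eq _).mp h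
      refine ⟨b - f a, ?_⟩
      rw [map_sub, ← LinearMap.comp_apply, ha]
      exact sub_sub_cancel _ _

theorem Module.length_quotient_ne_top_of_smul_mem {R M : Type*} [CommRing R] [IsNoetherianRing R]
    [Ring.KrullDimLE 1 R] [AddCommGroup M] [Module R M] [Module.Finite R M] {c : R}
    (hc : c ∈ nonZeroDivisors R) (N : Submodule R M) (h : ∀ m : M, c • m ∈ N) :
    Module.length R (M ⧸ N) ≠ ⊤ := by
  have hfl := (isFiniteLength_iff_isNoetherian_isArtinian.mp
    (isFiniteLength_quotient_span_singleton R hc)).2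
  obtain ⟨n, f, hf⟩ := Module.Finite.exists_fin' R M
  let F : (Fin n → R) →ₗ[R] M ⧸ N := N.mkQ ∘ₗ f
  have hF : Function.Surjective F := (Submodule.mkQ_surjective _).comp hf
  have hle : Submodule.pi Set.univ (fun _ : Fin n => (Ideal.span {c} : Submodule R R)) ≤
      LinearMap.ker F := by
    intro v hv
    choose w hw using fun i => Ideal.mem_span_singleton'.mp (hv i (Set.mem_univ i))
    have : v = c • w := by ext i; simp [← hw i, mul_comm]
    rw [this, LinearMap.mem_ker]
    rw [map_smul, ← map_smul, LinearMap.comp_apply, Submodule.mkQ_apply, map_smul,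
      Submodule.Quotient.mk_eq_zero]
    exact h (f w)
  have : IsArtinian R ((Fin n → R) ⧸ Submodule.pi Set.univ
      (fun _ : Fin n => (Ideal.span {c} : Submodule R R))) :=
    (Submodule.quotientPi (fun _ : Fin n => (Ideal.span {c} : Submodule R R))).symm.isArtinian_iff.mp inferInstance
  have : IsArtinian R (M ⧸ N) := isArtinian_of_surjective _ (Submodule.liftQ _ F hle)
    (fun y => by obtain ⟨x, rfl⟩ := hF y; exact ⟨Submodule.Quotient.mk x, by simp⟩)
  exact Module.length_ne_top

theorem Module.length_quotient_smul_eq_finrank_mul_ord {R M : Type*} [CommRing R] [IsDomain R]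
    [IsNoetherianRing R] [Ring.KrullDimLE 1 R] [AddCommGroup M] [Module R M] [Module.Finite R M]
    [Module.IsTorsionFree R M] {x : R} (hx : x ≠ 0) :
    Module.length R (M ⧸ LinearMap.range (LinearMap.lsmul R M x)) =
      Module.finrank R M * Ring.ord R x := by
  obtain ⟨b, hb⟩ := exists_linearIndependent_of_le_finrank (R := R) (M := M) le_rfl
  let f : (Fin (Module.finrank R M) → R) →ₗ[R] M := Fintype.linearCombination R b
  have hf : Function.Injective f := hb.fintypeLinearCombination_injective
  have htors : Module.IsTorsion R (M ⧸ LinearMap.range f) := by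
    rw [← Module.rank_eq_zero_iff_isTorsion]
    have h1 := Submodule.finrank_quotient_add_finrank (LinearMap.range f)
    rw [LinearMap.finrank_range_of_inj hf, Module.finrank_fin_fun, Nat.add_eq_right] at h1
    rw [← Module.finrank_eq_rank, h1, Nat.cast_zero]
  obtain ⟨c, hc, hc0⟩ := Submodule.annihilator_top_inter_nonZeroDivisors htors
  have hfin : Module.length R (M ⧸ LinearMap.range f) ≠ ⊤ := by
    refine Module.length_quotient_ne_top_of_smul_mem hc0 _ fun m => ?_
    rw [← Submodule.Quotient.mk_eq_zero, Submodule.Quotient.mk_smul]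
    exact Submodule.mem_annihilator.mp hc _ Submodule.mem_top
  have hcomm : LinearMap.lsmul R M x ∘ₗ f = f ∘ₗ LinearMap.lsmul R _ x := by
    ext; simp
  have h1 := Module.length_quotient_range_comp f (LinearMap.lsmul R M x)
    (LinearMap.lsmul_injective hx)
  rw [hcomm, Module.length_quotient_range_comp _ f hf, add_comm] at h1
  rw [← ENat.add_right_injective_of_ne_top hfin h1]
  have hrange : LinearMap.range (LinearMap.lsmul R (Fin (Module.finrank R M) → R) x) =
      Submodule.pi Set.univ (fun _ => (Ideal.span {x} : Submodule R R)) := by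
    ext v
    simp only [LinearMap.mem_range, LinearMap.lsmul_apply, Submodule.mem_pi, Set.mem_univ,
      forall_const, Ideal.mem_span_singleton']
    refine ⟨?_, fun h => ?_⟩
    · rintro ⟨w, rfl⟩ i
      exact ⟨w i, mul_comm _ _⟩
    · choose w hw using h
      exact ⟨w, by ext i; simp [← hw i, mul_comm]⟩
  rw [hrange, (Submodule.quotientPi fun _ => (Ideal.span {x} : Submodule R R)).length_eq,
    Module.length_pi, Ring.ord]
  simp

theorem IsLocalRing.finrank_mul_ord {R S : Type*} [CommRing R] [IsDomain R] [IsLocalRing R]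
    [IsNoetherianRing R] [Ring.KrullDimLE 1 R] [CommRing S] [IsDomain S] [IsLocalRing S]
    [Algebra R S] [IsLocalHom (algebraMap R S)] [Module.Finite R S] [Module.IsTorsionFree R S]
    {x : R} (hx : x ≠ 0) :
    Module.finrank R S * Ring.ord R x =
      Ring.ord S (algebraMap R S x) * Module.finrank (ResidueField R) (ResidueField S) := by
  rw [← Module.length_quotient_smul_eq_finrank_mul_ord hx, ← Module.length_eq_finrank, Ring.ord,
    ← IsLocalRing.length_restrictScalars]
  refine (Submodule.quotEquivOfEq _
    ((Ideal.span {algebraMap R S x}).restrictScalars R) ?_).length_eq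
  ext y
  simp [Ideal.mem_span_singleton', Algebra.smul_def, mul_comm]

theorem RingHom.Finite.iterateFrobenius_of_frobenius {A : Type*} [CommRing A] {p : ℕ} [ExpChar A p]
    (h : (frobenius A p).Finite) (e : ℕ) : (iterateFrobenius A p e).Finite := by
  induction e with
  | zero => rw [iterateFrobenius_zero]; exact RingHom.Finite.id A
  | succ n ih => rw [iterateFrobenius_add, iterateFrobenius_one]; exact ih.comp h

theorem RingHom.Finite.frobenius_of_surjective {A B : Type*} [CommRing A] [CommRing B] {p : ℕ}
    [ExpChar A p] [ExpChar B p] (h : (frobenius A p).Finite) (f : A →+* B)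
    (hf : Function.Surjective f) : (frobenius B p).Finite := by
  have h1 := (RingHom.Finite.of_surjective f hf).comp h
  rw [f.frobenius_comm] at h1
  exact h1.of_comp_finite

theorem RingHom.Finite.frobenius_of_isLocalization {A : Type*} [CommRing A] (M : Submonoid A)
    (B : Type*) [CommRing B] [Algebra A B] [IsLocalization M B] {p : ℕ} [Fact p.Prime]
    [CharP A p] [CharP B p] (h : (frobenius A p).Finite) : (frobenius B p).Finite := by
  have : Module.Finite A (FrobAlg p 1 A) := h.iterateFrobenius_of_frobenius 1
  have : IsScalarTower A B (FrobAlg p 1 B) := .of_algebraMap_eq' rfl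
  let f : FrobAlg p 1 A →ₗ[A] FrobAlg p 1 B :=
    { toFun := algebraMap A B
      map_add' := map_add (algebraMap A B)
      map_smul' := fun a x => by
        have hx := (algebraMap A B).map_mul (iterateFrobenius A p 1 a) x
        rw [RingHom.map_iterateFrobenius] at hx
        exact hx }
  have hf : Function.Surjective (f.liftBaseChange B) := by
    intro (b : B)
    obtain ⟨a, m, rfl⟩ := IsLocalization.exists_mk'_eq M b
    refine ⟨TensorProduct.tmul A (IsLocalization.mk' B 1 m) (a * (m : A) ^ (p - 1) : A), ?_⟩
    refine (LinearMap.liftBaseChange_tmul ..).trans ((Algebra.smul_def _ _).trans ?_)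
    change (iterateFrobenius B p 1) (IsLocalization.mk' B 1 m) *
      algebraMap A B (a * (m : A) ^ (p - 1)) = IsLocalization.mk' B a m
    rw [iterateFrobenius_one_apply, ← IsLocalization.mk'_pow, one_pow, mul_comm,
      ← IsLocalization.mk'_eq_mul_mk'_one, IsLocalization.mk'_eq_iff_eq, mul_comm (m : A),
      mul_assoc, SubmonoidClass.coe_pow, pow_sub_one_mul (Fact.out : p.Prime).ne_zero, mul_comm]
  have hB : Module.Finite B (FrobAlg p 1 B) := Module.Finite.of_surjective _ hf
  rw [← iterateFrobenius_one]
  exact hB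

theorem pDeg_congr (p e : ℕ) {k l : Type*} [CommRing k] [CommRing l] [ExpChar k p] [ExpChar l p]
    (f : k ≃+* l) : pDeg p e k = pDeg p e l :=
  Algebra.finrank_eq_of_equiv_equiv f (show FrobAlg p e k ≃+* FrobAlg p e l from f) <|
    (f : k →+* l).iterateFrobenius_comm p e |>.symm

theorem pDeg_residueField_mul_pow (p e : ℕ) [Fact p.Prime] {R K : Type*} [CommRing R] [IsDomain R]
    [IsLocalRing R] [IsNoetherianRing R] [CharP R p] [Field K] [Algebra R K] [IsFractionRing R K]
    [ExpChar K p] [ExpChar (ResidueField R) p] (hfin : (frobenius R p).Finite)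
    (hdim : ringKrullDim R = 1) :
    pDeg p e K = pDeg p e (ResidueField R) * p ^ e := by
  let S := FrobAlg p e R
  have : IsDomain S := inferInstanceAs (IsDomain R)
  have : IsLocalRing S := inferInstanceAs (IsLocalRing R)
  have : Ring.KrullDimLE 1 R := Ring.krullDimLE_iff.mpr hdim.le
  have hmap (x : R) : algebraMap R S x = (x ^ p ^ e : R) := rfl
  have hp : p ^ e ≠ 0 := pow_ne_zero _ (Fact.out : p.Prime).ne_zero
  have : IsLocalHom (algebraMap R S) :=
    ⟨fun x hx => (isUnit_pow_iff hp).mp (show IsUnit (M := R) (x ^ p ^ e) from hx)⟩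
  have : Module.Finite R S := hfin.iterateFrobenius_of_frobenius e
  have : FaithfulSMul R S := (faithfulSMul_iff_algebraMap_injective R S).mpr
    (iterateFrobenius_inj R p e)
  have hK : Module.finrank R S = pDeg p e K := by
    let : Algebra S (FrobAlg p e K) := ‹Algebra R K›
    have : IsFractionRing S (FrobAlg p e K) := ‹IsFractionRing R K›
    have : IsScalarTower R S (FrobAlg p e K) := .of_algebraMap_eq' <|
      ((algebraMap R K).iterateFrobenius_comm p e).symm
    have : IsScalarTower R K (FrobAlg p e K) := .of_algebraMap_eq' rfl
    exact (IsFractionRing.finrank_eq R K S (FrobAlg p e K)).symm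
  have hk : Module.finrank (ResidueField R) (ResidueField S) = pDeg p e (ResidueField R) := by
    refine Algebra.finrank_eq_of_equiv_equiv (RingEquiv.refl _)
      (show ResidueField S ≃+* FrobAlg p e (ResidueField R) from RingEquiv.refl (ResidueField R)) ?_
    refine RingHom.ext fun y => ?_
    obtain ⟨y, rfl⟩ := residue_surjective (R := R) y
    exact (RingHom.map_iterateFrobenius (R := R) (residue R) p y e).symm
  obtain ⟨x, hxm, hx⟩ : ∃ x ∈ maximalIdeal R, x ≠ 0 := by
    apply Submodule.exists_mem_ne_zero_of_ne_bot
    rw [Ne, ← isField_iff_maximalIdeal_eq]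
    intro hf
    rw [ringKrullDim_eq_zero_of_isField hf] at hdim
    exact zero_ne_one hdim
  have hx0 := mem_nonZeroDivisors_of_ne_zero hx
  have key := IsLocalRing.finrank_mul_ord (R := R) (S := S) hx
  have hord : Ring.ord S (algebraMap R S x) = p ^ e • Ring.ord R x :=
    Ring.ord_pow (mem_nonZeroDivisors_of_ne_zero hx) (p ^ e)
  rw [hord, hK, hk] at key
  obtain ⟨n, hn⟩ := ENat.ne_top_iff_exists.mp (Ring.ord_ne_top hx0)
  have hn0 : n ≠ 0 := by
    rintro rfl
    rw [Nat.cast_zero, eq_comm, Ring.ord, Module.length_eq_zero_iff,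
      Ideal.Quotient.subsingleton_iff, Ideal.span_singleton_eq_top] at hn
    exact hxm hn
  rw [← hn, nsmul_eq_mul] at key
  norm_cast at key
  exact Nat.eq_of_mul_eq_mul_right (Nat.pos_of_ne_zero hn0) (by rw [key]; ring)

theorem CharP.of_ringHom_of_prime {A B : Type*} [Ring A] [Ring B] [Nontrivial B]
    (f : A →+* B) (p : ℕ) [Fact p.Prime] [CharP A p] : CharP B p :=
  CharP.of_ringHom_of_ne_zero (f.comp (ZMod.castHom dvd_rfl A)) p (Fact.out : p.Prime).ne_zero

theorem IsLocalRing.ResidueField.map_bijective_of_surjective {R S : Type*} [CommRing R]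
    [IsLocalRing R] [CommRing S] [IsLocalRing S] (f : R →+* S) [IsLocalHom f]
    (hf : Function.Surjective f) : Function.Bijective (ResidueField.map f) := by
  refine ⟨RingHom.injective _, fun y => ?_⟩
  obtain ⟨y, rfl⟩ := residue_surjective y
  obtain ⟨x, rfl⟩ := hf y
  exact ⟨residue R x, rfl⟩

theorem PrimeSpectrum.ringKrullDim_quotient_eq_coheight {R : Type*} [CommRing R]
    (P : PrimeSpectrum R) : ringKrullDim (R ⧸ P.asIdeal) = Order.coheight P := by
  rw [ringKrullDim_quotient, Order.coheight_eq_krullDim_Ici]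
  rfl

theorem exists_height_eq_one_of_ringKrullDim_eq {R : Type*} [CommRing R] {d : ℕ}
    (hd : ringKrullDim R = (d + 1 : ℕ)) :
    ∃ P : PrimeSpectrum R, P.asIdeal.height = 1 ∧ ringKrullDim (R ⧸ P.asIdeal) = d := by
  obtain ⟨l, hl⟩ := Order.le_krullDim_iff.mp hd.ge
  let i : Fin (l.length + 1) := ⟨1, by omega⟩
  have h1 : ((1 : ℕ) : ℕ∞) ≤ Order.height (l i) := Order.index_le_height l i
  have h2 : ((d : ℕ) : ℕ∞) ≤ Order.coheight (l i) := by
    have := Order.rev_index_le_coheight l i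
    simpa [Fin.val_rev, i, hl] using this
  have h3 : Order.height (l i) + Order.coheight (l i) ≤ ((d + 1 : ℕ) : ℕ∞) := by
    have : Nonempty (PrimeSpectrum R) := ⟨l i⟩
    rw [ringKrullDim, Order.krullDim_eq_iSup_height_add_coheight_of_nonempty] at hd
    rw [← WithBot.coe_inj.mp hd]
    exact le_iSup (fun a : PrimeSpectrum R => Order.height a + Order.coheight a) (l i)
  obtain ⟨m, hm⟩ := ENat.ne_top_iff_exists.mp
    (ne_top_of_le_ne_top (ENat.natCast_ne_top _) (le_self_add.trans h3))
  obtain ⟨n, hn⟩ := ENat.ne_top_iff_exists.mp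
    (ne_top_of_le_ne_top (ENat.natCast_ne_top _) (le_add_self.trans h3))
  rw [← hm] at h1
  rw [← hn] at h2
  rw [← hm, ← hn] at h3
  norm_cast at h1 h2 h3
  refine ⟨l i, ?_, ?_⟩
  · rw [PrimeSpectrum.height_eq_orderHeight, ← hm, show m = 1 by omega, Nat.cast_one]
  · rw [PrimeSpectrum.ringKrullDim_quotient_eq_coheight, ← hn, show n = d by omega]
    rfl

theorem pDeg_eq_pDeg_residueField_mul_pow.{u} (p e : ℕ) [Fact p.Prime] (d : ℕ) {B K : Type u}
    [CommRing B] [IsDomain B] [IsLocalRing B] [IsNoetherianRing B] [CharP B p]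
    [Field K] [Algebra B K] [IsFractionRing B K] [ExpChar K p] [ExpChar (ResidueField B) p]
    (hfin : (frobenius B p).Finite) (hd : ringKrullDim B = d) :
    pDeg p e K = pDeg p e (ResidueField B) * p ^ (e * d) := by
  induction d generalizing B K with
  | zero =>
    have : Ring.KrullDimLE 0 B := Ring.krullDimLE_iff.mpr hd.le
    have hB : IsField B := Ring.KrullDimLE.isField_of_isDomain
    rw [mul_zero, pow_zero, mul_one,
      ← pDeg_congr p e (RingEquiv.ofBijective (algebraMap B K)
        ⟨IsFractionRing.injective B K, IsFractionRing.surjective_iff_isField.mpr hB⟩)]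
    refine pDeg_congr p e (RingEquiv.ofBijective (residue B) ⟨?_, residue_surjective⟩)
    rw [RingHom.injective_iff_ker_eq_bot, ker_residue, ← isField_iff_maximalIdeal_eq]
    exact hB
  | succ d ih =>
    obtain ⟨P, hP, hPd⟩ := exists_height_eq_one_of_ringKrullDim_eq hd
    let R := Localization.AtPrime P.asIdeal
    have hR : ringKrullDim R = 1 := by
      rw [IsLocalization.AtPrime.ringKrullDim_eq_height P.asIdeal R, hP]; rfl
    have : CharP R p := .of_ringHom_of_prime (algebraMap B R) p
    have : CharP P.asIdeal.ResidueField p :=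
      .of_ringHom_of_prime (algebraMap B P.asIdeal.ResidueField) p
    have : CharP (B ⧸ P.asIdeal) p := .of_ringHom_of_prime (Ideal.Quotient.mk P.asIdeal) p
    have hunit (y : P.asIdeal.primeCompl) : IsUnit (algebraMap B K y) :=
      IsUnit.mk0 _ <| (map_ne_zero_iff _ (IsFractionRing.injective B K)).mpr fun h =>
        y.2 (h ▸ zero_mem _)
    let : Algebra R K := (IsLocalization.lift hunit).toAlgebra
    have : IsScalarTower B R K := .of_algebraMap_eq' (IsLocalization.lift_comp hunit).symm
    have : IsFractionRing R K :=
      IsFractionRing.isFractionRing_of_isDomain_of_isLocalization P.asIdeal.primeCompl R K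
    have : IsLocalRing (B ⧸ P.asIdeal) := .of_surjective' _ Ideal.Quotient.mk_surjective
    have : IsLocalHom (Ideal.Quotient.mk P.asIdeal) := .of_surjective _ Ideal.Quotient.mk_surjective
    have : CharP (ResidueField (B ⧸ P.asIdeal)) p :=
      .of_ringHom_of_prime (residue (B ⧸ P.asIdeal)) p
    have h1 : pDeg p e K = pDeg p e P.asIdeal.ResidueField * p ^ e :=
      pDeg_residueField_mul_pow p e (hfin.frobenius_of_isLocalization P.asIdeal.primeCompl R) hR
    have h2 := ih (K := P.asIdeal.ResidueField)
      (hfin.frobenius_of_surjective _ Ideal.Quotient.mk_surjective) hPd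
    rw [h1, h2, pDeg_congr p e (RingEquiv.ofBijective _
      (ResidueField.map_bijective_of_surjective _ (Ideal.Quotient.mk_surjective (I := P.asIdeal))))]
    ring

theorem pDeg_fractionRing_quotient (p e : ℕ) {A : Type*} [CommRing A] (P : Ideal A) [P.IsPrime]
    [ExpChar (FractionRing (A ⧸ P)) p] [ExpChar P.ResidueField p] :
    pDeg p e (FractionRing (A ⧸ P)) = pDeg p e P.ResidueField :=
  pDeg_congr p e (FractionRing.algEquiv (A ⧸ P) P.ResidueField).toRingEquiv

theorem pDeg_residueField_eq_of_mem_minimalPrimes (p e : ℕ) [Fact p.Prime] {A : Type*}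
    [CommRing A] [IsNoetherianRing A] [CharP A p] (hfin : (frobenius A p).Finite)
    {P Q : Ideal A} [P.IsPrime] [Q.IsPrime] (hP : P ∈ minimalPrimes A) (hPQ : P ≤ Q)
    (hQ : RingEquidim (Localization.AtPrime Q))
    [CharP P.ResidueField p] [CharP Q.ResidueField p] {h : ℕ}
    (hh : ringKrullDim (Localization.AtPrime Q) = h) :
    pDeg p e P.ResidueField = pDeg p e Q.ResidueField * p ^ (e * h) := by
  let S := Localization.AtPrime Q
  have : CharP S p := .of_ringHom_of_prime (algebraMap A S) p
  have hfinS : (frobenius S p).Finite := hfin.frobenius_of_isLocalization Q.primeCompl S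
  have hdisj : Disjoint (Q.primeCompl : Set A) P :=
    Set.disjoint_left.mpr fun _ hx hx' => hx (hPQ hx')
  let P' : Ideal S := P.map (algebraMap A S)
  have : P'.IsPrime := IsLocalization.isPrime_of_isPrime_disjoint Q.primeCompl S P ‹_› hdisj
  have hcomap : P'.under A = P :=
    IsLocalization.under_map_of_isPrime_disjoint Q.primeCompl S ‹P.IsPrime› hdisj
  have hP' : P' ∈ minimalPrimes S := by
    have := IsLocalization.minimalPrimes_map Q.primeCompl S (⊥ : Ideal A)
    rw [Ideal.map_bot] at this
    refine (Set.ext_iff.mp this P').mpr ?_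
    rw [Set.mem_preimage, hcomap]
    exact hP
  have hdim : ringKrullDim (S ⧸ P') = h := (hQ P' hP').trans hh
  have : CharP P'.ResidueField p := .of_ringHom_of_prime (algebraMap S P'.ResidueField) p
  have : CharP (S ⧸ P') p := .of_ringHom_of_prime (Ideal.Quotient.mk P') p
  have : IsLocalRing (S ⧸ P') := .of_surjective' _ Ideal.Quotient.mk_surjective
  have : IsLocalHom (Ideal.Quotient.mk P') := .of_surjective _ Ideal.Quotient.mk_surjective
  have : CharP (ResidueField (S ⧸ P')) p := .of_ringHom_of_prime (residue (S ⧸ P')) p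
  rw [pDeg_congr p e (RingEquiv.ofBijective _
      ((RingHom.surjectiveOnStalks_of_isLocalization Q.primeCompl S).residueFieldMap_bijective
        P P' hcomap.symm)),
    pDeg_eq_pDeg_residueField_mul_pow p e h (B := S ⧸ P')
      (hfinS.frobenius_of_surjective _ Ideal.Quotient.mk_surjective) hdim]
  congr 1
  exact (pDeg_congr p e (RingEquiv.ofBijective _
    (ResidueField.map_bijective_of_surjective _ (Ideal.Quotient.mk_surjective (I := P'))))).symm

theorem PrimeSpectrum.apply_eq_of_mem_connectedComponent {A α : Type*} [CommRing A]
    [IsNoetherianRing A] {f : PrimeSpectrum A → α}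
    (hf : ∀ P Q : PrimeSpectrum A, P ≤ Q → f P = f Q) {P Q : PrimeSpectrum A}
    (hPQ : Q ∈ connectedComponent P) : f P = f Q := by
  have hclosed (s : Set α) : IsClosed (f ⁻¹' s) := by
    have : f ⁻¹' s = ⋃ I ∈ {I ∈ minimalPrimes A | ∃ h : I.IsPrime, f ⟨I, h⟩ ∈ s},
        zeroLocus (I : Set A) := by
      ext x
      simp only [Set.mem_preimage, Set.mem_iUnion, mem_zeroLocus, SetLike.coe_subset_coe,
        exists_prop, Set.mem_ofPred_eq]
      constructor
      · intro hx
        obtain ⟨I, hI, hIx⟩ := Ideal.exists_minimalPrimes_le (bot_le (a := x.asIdeal))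
        exact ⟨I, ⟨hI, hI.1.1, (hf ⟨I, hI.1.1⟩ x hIx).symm ▸ hx⟩, hIx⟩
      · rintro ⟨I, ⟨_, hI, hIs⟩, hIx⟩
        exact hf ⟨I, hI⟩ x hIx ▸ hIs
    rw [this]
    exact ((minimalPrimes.finite_of_isNoetherianRing A).subset (Set.sep_subset _ _)).isClosed_biUnion
      fun I _ => isClosed_zeroLocus _
  have hloc : IsLocallyConstant f := fun s => by
    rw [← isClosed_compl_iff, ← Set.preimage_compl]
    exact hclosed sᶜ
  exact hloc.apply_eq_of_isPreconnected isPreconnected_connectedComponent mem_connectedComponent hPQ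

/-- For an `F`-finite Noetherian locally equidimensional ring `A` of prime characteristic
`p` and primes `𝔭 ⊆ 𝔮`, one has
`[κ(𝔭)^{1/p^e}:κ(𝔭)] ⬝ p^{e dim A_𝔭} = [κ(𝔮)^{1/p^e}:κ(𝔮)] ⬝ p^{e dim A_𝔮}`; consequently
`𝔭 ↦ [κ(𝔭)^{1/p^e}:κ(𝔭)] p^{e dim A_𝔭}` is constant on connected components of `Spec A`. -/
theorem stmt9 (p : ℕ) [Fact p.Prime] (A : Type*) [CommRing A] [IsNoetherianRing A]
    [CharP A p] [Module.Finite A (FrobAlg p 1 A)]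
    (hloceq : ∀ Q : PrimeSpectrum A, RingEquidim (Localization.AtPrime Q.asIdeal))
    (P Q : PrimeSpectrum A)
    [CharP (FractionRing (A ⧸ P.asIdeal)) p]
    [CharP (FractionRing (A ⧸ Q.asIdeal)) p]
    (hP hQ : ℕ)
    (hhP : ringKrullDim (Localization.AtPrime P.asIdeal) = hP)
    (hhQ : ringKrullDim (Localization.AtPrime Q.asIdeal) = hQ)
    (e : ℕ) (he : 0 < e) :
    (P.asIdeal ≤ Q.asIdeal →
      pDeg p e (FractionRing (A ⧸ P.asIdeal)) * p ^ (e * hP) =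
        pDeg p e (FractionRing (A ⧸ Q.asIdeal)) * p ^ (e * hQ)) ∧
    (Q ∈ connectedComponent P →
      pDeg p e (FractionRing (A ⧸ P.asIdeal)) * p ^ (e * hP) =
        pDeg p e (FractionRing (A ⧸ Q.asIdeal)) * p ^ (e * hQ)) := by
  have hfin : (frobenius A p).Finite := by
    rw [← iterateFrobenius_one]
    exact ‹Module.Finite A (FrobAlg p 1 A)›
  have hchar (R : PrimeSpectrum A) : CharP R.asIdeal.ResidueField p :=
    .of_ringHom_of_prime (algebraMap A R.asIdeal.ResidueField) p
  have hdim (R : PrimeSpectrum A) :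
      ∃ h : ℕ, ringKrullDim (Localization.AtPrime R.asIdeal) = h := by
    obtain ⟨h, hh⟩ := ENat.ne_top_iff_exists.mp
      (Ideal.height_ne_top_of_isPrime (I := R.asIdeal))
    refine ⟨h, ?_⟩
    rw [IsLocalization.AtPrime.ringKrullDim_eq_height R.asIdeal, ← hh]
    rfl
  choose h hh using hdim
  have hle (R T : PrimeSpectrum A) (hRT : R ≤ T) :
      pDeg p e R.asIdeal.ResidueField * p ^ (e * h R) =
        pDeg p e T.asIdeal.ResidueField * p ^ (e * h T) := by
    obtain ⟨I, hI, hIR⟩ := Ideal.exists_minimalPrimes_le (bot_le (a := R.asIdeal))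
    have : I.IsPrime := hI.1.1
    have : CharP I.ResidueField p := hchar ⟨I, this⟩
    rw [← pDeg_residueField_eq_of_mem_minimalPrimes p e hfin hI hIR (hloceq R) (hh R),
      ← pDeg_residueField_eq_of_mem_minimalPrimes p e hfin hI (hIR.trans hRT) (hloceq T) (hh T)]
  obtain rfl : h P = hP := by exact_mod_cast (hh P).symm.trans hhP
  obtain rfl : h Q = hQ := by exact_mod_cast (hh Q).symm.trans hhQ
  rw [pDeg_fractionRing_quotient, pDeg_fractionRing_quotient]
  exact ⟨hle P Q, PrimeSpectrum.apply_eq_of_mem_connectedComponent hle⟩
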